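/- If the defining ideal I_A of the monomial curve is generated by its indispensable binomials (i.e., has a unique minimal system of binomial generators), then the critical ideal C_A is also generated by its indispensable binomials. -/

import Mathlib

open MvPolynomial Finsupp

variable (K : Type*) [Field K]

/-- The `A`-degree of an exponent vector `u ∈ ℕ^n` with respect to `a_1, …, a_n ∈ ℕ`, namely
`∑ i, u i * a i`. -/
def degN {n : ℕ} (a : Fin n → ℕ) (u : Fin n →₀ ℕ) : ℕ :=
  ∑ i, u i * a i

/-- The defining ideal `I_A` of the monomial curve `x_i = t^{a_i}`: the ideal generated by all
binomials `x^u - x^v` with `∑ u_i a_i = ∑ v_i a_i` (equivalently, the kernel of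
`k[x_1,…,x_n] → k[t]`, `x_i ↦ t^{a_i}`). -/
noncomputable def curveIdeal {n : ℕ} (a : Fin n → ℕ) : Ideal (MvPolynomial (Fin n) K) :=
  Ideal.span { f | ∃ u v : Fin n →₀ ℕ, degN a u = degN a v ∧
    f = monomial u (1 : K) - monomial v (1 : K) }

/-- `c` is the critical exponent of the variable `x_i`: the least positive integer `c` with
`c * a_i ∈ ∑_{j ≠ i} ℕ a_j`. -/
def IsCritExp {n : ℕ} (a : Fin n → ℕ) (i : Fin n) (c : ℕ) : Prop :=
  IsLeast { m : ℕ | 0 < m ∧ ∃ u : Fin n →₀ ℕ, u i = 0 ∧ m * a i = degN a u } c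

/-- `f` is a critical binomial of `I_A` with respect to `x_i` (where `c` is the vector of
critical exponents): `f = x_i^{c_i} - ∏_{j ≠ i} x_j^{u_{ij}} ∈ I_A`. -/
def IsCritBinom {n : ℕ} (a c : Fin n → ℕ) (i : Fin n) (f : MvPolynomial (Fin n) K) : Prop :=
  ∃ u : Fin n →₀ ℕ, u i = 0 ∧
    f = monomial (Finsupp.single i (c i)) (1 : K) - monomial u (1 : K) ∧
    f ∈ curveIdeal K a

/-- The critical ideal `C_A`: the ideal generated by all critical binomials of `I_A`. -/
noncomputable def criticalIdeal {n : ℕ} (a c : Fin n → ℕ) :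
    Ideal (MvPolynomial (Fin n) K) :=
  Ideal.span { f | ∃ i : Fin n, IsCritBinom K a c i f }

/-- `S` is a set of binomials generating `J`. -/
def IsBinomGenSet {σ : Type*} (J : Ideal (MvPolynomial σ K)) (S : Set (MvPolynomial σ K)) :
    Prop :=
  (∀ f ∈ S, ∃ u v : σ →₀ ℕ, f = monomial u (1 : K) - monomial v (1 : K)) ∧
  Ideal.span S = J

/-- The monomial `x^u` is an indispensable monomial of `J`: every set of binomials generating `J`
contains a binomial one of whose monomials is `x^u`. -/
def IndispMonomial {σ : Type*} (J : Ideal (MvPolynomial σ K)) (u : σ →₀ ℕ) : Prop :=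
  ∀ S : Set (MvPolynomial σ K), IsBinomGenSet K J S → ∃ f ∈ S, u ∈ f.support

/-- `f` is an indispensable binomial of `J`: every set of binomials generating `J` contains
`f` or `-f`. -/
def IndispBinomial {σ : Type*} (J : Ideal (MvPolynomial σ K)) (f : MvPolynomial σ K) : Prop :=
  ∀ S : Set (MvPolynomial σ K), IsBinomGenSet K J S → f ∈ S ∨ -f ∈ S

/-- `x^u - x^v` is a primitive binomial of `I_A`: it is a nonzero binomial of `I_A` and there is
no other nonzero binomial `x^{u'} - x^{v'} ∈ I_A` with `x^{u'} ∣ x^u` and `x^{v'} ∣ x^v`. -/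
def IsPrimitive {n : ℕ} (a : Fin n → ℕ) (u v : Fin n →₀ ℕ) : Prop :=
  u ≠ v ∧ (monomial u (1 : K) - monomial v (1 : K)) ∈ curveIdeal K a ∧
  ∀ u' v' : Fin n →₀ ℕ, u' ≤ u → v' ≤ v → u' ≠ v' →
    (monomial u' (1 : K) - monomial v' (1 : K)) ∈ curveIdeal K a → u' = u ∧ v' = v

lemma degN_single {n : ℕ} (a : Fin n → ℕ) (i : Fin n) (m : ℕ) :
    degN a (Finsupp.single i m) = m * a i := by
  unfold degN
  rw [Finset.sum_eq_single i]
  · simp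
  · intro j _ hj
    simp [Finsupp.single_eq_of_ne hj]
  · simp

lemma degN_add {n : ℕ} (a : Fin n → ℕ) (u v : Fin n →₀ ℕ) :
    degN a (u + v) = degN a u + degN a v := by
  simp [degN, add_mul, Finset.sum_add_distrib]

lemma eq_zero_of_degN_eq_zero {n : ℕ} {a : Fin n → ℕ} (ha : ∀ i, 0 < a i)
    {u : Fin n →₀ ℕ} (h : degN a u = 0) : u = 0 := by
  ext i
  have h_term := (Finset.sum_eq_zero_iff.mp h) i (Finset.mem_univ i)
  simpa [(ha i).ne'] using h_term

lemma aeval_monomial_eq_X_pow_degN {n : ℕ} (a : Fin n → ℕ) (u : Fin n →₀ ℕ) :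
    aeval (fun i => (Polynomial.X : Polynomial K) ^ a i) (monomial u (1 : K)) =
      Polynomial.X ^ degN a u := by
  rw [aeval_monomial, map_one, one_mul, Finsupp.prod_fintype _ _ (by simp), degN,
    ← Finset.prod_pow_eq_pow_sum]
  exact Finset.prod_congr rfl fun i _ => by rw [← pow_mul, mul_comm]

/-- A binomial lies in `I_A` only if its two monomials have the same `A`-degree. -/
lemma degN_eq_of_mem_curveIdeal {n : ℕ} {a : Fin n → ℕ} {u v : Fin n →₀ ℕ}
    (h : monomial u (1 : K) - monomial v (1 : K) ∈ curveIdeal K a) :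
    degN a u = degN a v := by
  have h_le : curveIdeal K a ≤
      RingHom.ker (aeval (R := K) fun i => (Polynomial.X : Polynomial K) ^ a i) := by
    refine Ideal.span_le.mpr ?_
    rintro _ ⟨p, q, hpq, rfl⟩
    simp only [SetLike.mem_coe, RingHom.mem_ker, map_sub, aeval_monomial_eq_X_pow_degN, hpq,
      sub_self]
  have h_ker := h_le h
  rw [RingHom.mem_ker, map_sub, aeval_monomial_eq_X_pow_degN, aeval_monomial_eq_X_pow_degN,
    sub_eq_zero] at h_ker
  simpa using congrArg Polynomial.natDegree h_ker

lemma mem_curveIdeal_of_degN_eq {n : ℕ} {a : Fin n → ℕ} {u v : Fin n →₀ ℕ}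
    (h : degN a u = degN a v) :
    monomial u (1 : K) - monomial v (1 : K) ∈ curveIdeal K a :=
  Ideal.subset_span ⟨u, v, h, rfl⟩

lemma criticalIdeal_le_curveIdeal {n : ℕ} (a c : Fin n → ℕ) :
    criticalIdeal K a c ≤ curveIdeal K a := by
  refine Ideal.span_le.mpr ?_
  rintro f ⟨i, u, -, -, hf⟩
  exact hf

/-- If `x^d` occurs in an element of the ideal spanned by `S`, then some monomial of an element
of `S` divides `x^d`. -/
lemma exists_coeff_ne_zero_of_mem_span {σ : Type*} {S : Set (MvPolynomial σ K)}
    {f : MvPolynomial σ K} (hf : f ∈ Ideal.span S) {d : σ →₀ ℕ} (hd : coeff d f ≠ 0) :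
    ∃ s ∈ S, ∃ m ≤ d, coeff m s ≠ 0 := by
  classical
  by_contra! hS
  refine hd ?_
  suffices ∀ m ≤ d, coeff m f = 0 from this d le_rfl
  clear hd
  induction hf using Submodule.span_induction with
  | mem x hx => exact hS x hx
  | zero => simp
  | add x y _ _ hx hy =>
    intro m hm
    rw [coeff_add, hx m hm, hy m hm, add_zero]
  | smul r x _ hx =>
    intro m hm
    rw [smul_eq_mul, coeff_mul]
    refine Finset.sum_eq_zero fun p hp => ?_
    have h_le : p.2 ≤ m := by
      rw [← Finset.HasAntidiagonal.mem_antidiagonal.mp hp]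
      exact le_add_self
    rw [hx _ (h_le.trans hm), mul_zero]

/-- A power of `x_i` of exponent at most `c_i` occurring in a nonzero homogeneous binomial is
`x_i^{c_i}` itself. -/
lemma IsCritExp.eq_of_degN_eq {n : ℕ} {a : Fin n → ℕ} (ha : ∀ i, 0 < a i) {i : Fin n} {c : ℕ}
    (hc : IsCritExp a i c) {p q : Fin n →₀ ℕ} (hp : p ≤ Finsupp.single i c) (hpq : p ≠ q)
    (hdeg : degN a p = degN a q) : p = Finsupp.single i c := by
  obtain ⟨k, rfl⟩ : ∃ k, p = Finsupp.single i k := by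
    refine ⟨p i, ?_⟩
    ext j
    by_cases hj : j = i
    · subst hj
      simp
    · have := hp j
      simp only [Finsupp.single_eq_of_ne hj] at this ⊢
      omega
  have hk : k ≤ c := by simpa using hp i
  rw [degN_single] at hdeg
  have hq : q = Finsupp.single i (q i) + q.erase i := (Finsupp.single_add_erase i q).symm
  have hdeg' : k * a i = q i * a i + degN a (q.erase i) := by
    rw [hdeg]
    conv_lhs => rw [hq]
    rw [degN_add, degN_single]
  have hqk : q i ≤ k := Nat.le_of_mul_le_mul_right (by omega) (ha i)
  have hsub : (k - q i) * a i = degN a (q.erase i) := by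
    rw [Nat.sub_mul]
    omega
  rcases Nat.eq_zero_or_pos (k - q i) with h0 | hpos
  · rw [h0, zero_mul] at hsub
    have h_erase := eq_zero_of_degN_eq_zero ha hsub.symm
    rw [h_erase, add_zero] at hq
    exact absurd (by rw [hq, le_antisymm hqk (by omega)]) hpq
  · have := hc.2 ⟨hpos, q.erase i, Finsupp.erase_same, hsub⟩
    rw [show k = c by omega]

/-- A set of binomials of `I_A` whose span contains a critical binomial with respect to `x_i`
contains, up to sign, a binomial `x_i^{c_i} - x^w`. -/
lemma exists_binomial_of_isCritBinom {n : ℕ} {a c : Fin n → ℕ} (ha : ∀ i, 0 < a i)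
    (hc : ∀ i, IsCritExp a i (c i)) {i : Fin n} {f : MvPolynomial (Fin n) K}
    (hcrit : IsCritBinom K a c i f) {S : Set (MvPolynomial (Fin n) K)}
    (hbin : ∀ s ∈ S, ∃ u v : Fin n →₀ ℕ, s = monomial u (1 : K) - monomial v (1 : K))
    (hS : S ⊆ curveIdeal K a) (hf : f ∈ Ideal.span S) :
    ∃ w, w ≠ Finsupp.single i (c i) ∧ degN a w = degN a (Finsupp.single i (c i)) ∧
      (monomial (Finsupp.single i (c i)) (1 : K) - monomial w 1 ∈ S ∨
        monomial w (1 : K) - monomial (Finsupp.single i (c i)) 1 ∈ S) := by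
  classical
  obtain ⟨u, hu, rfl, -⟩ := hcrit
  have hne : u ≠ Finsupp.single i (c i) := by
    rintro rfl
    exact (hc i).1.1.ne' (by simpa using hu)
  obtain ⟨s, hs, m, hm, hms⟩ := exists_coeff_ne_zero_of_mem_span K hf
    (d := Finsupp.single i (c i)) (by simp [coeff_monomial, hne])
  obtain ⟨p, q, rfl⟩ := hbin s hs
  have hdeg := degN_eq_of_mem_curveIdeal K (hS hs)
  have hpq : p ≠ q := by
    rintro rfl
    simp at hms
  have hmem : m = p ∨ m = q := by
    by_contra! h
    simp [coeff_monomial, h.1.symm, h.2.symm] at hms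
  rcases hmem with rfl | rfl
  · obtain rfl := (hc i).eq_of_degN_eq ha hm hpq hdeg
    exact ⟨q, hpq.symm, hdeg.symm, Or.inl hs⟩
  · obtain rfl := (hc i).eq_of_degN_eq ha hm hpq.symm hdeg.symm
    exact ⟨p, hpq, hdeg, Or.inr hs⟩

lemma isBinomGenSet_setOf_degN_eq {n : ℕ} (a : Fin n → ℕ) :
    IsBinomGenSet K (curveIdeal K a) { f | ∃ u v : Fin n →₀ ℕ, degN a u = degN a v ∧
      f = monomial u (1 : K) - monomial v (1 : K) } :=
  ⟨fun _ ⟨u, v, _, hf⟩ => ⟨u, v, hf⟩, rfl⟩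

lemma IndispBinomial.exists_degN_eq {n : ℕ} {a : Fin n → ℕ} {f : MvPolynomial (Fin n) K}
    (hf : IndispBinomial K (curveIdeal K a) f) :
    ∃ u v : Fin n →₀ ℕ, degN a u = degN a v ∧ f = monomial u (1 : K) - monomial v (1 : K) := by
  rcases hf _ (isBinomGenSet_setOf_degN_eq K a) with h | ⟨u, v, huv, h⟩
  · exact h
  · exact ⟨v, u, huv.symm, by rw [← neg_neg f, h, neg_sub]⟩

/-- The fiber of an indispensable binomial of `I_A` consists of its two monomials. -/
lemma IndispBinomial.eq_or_eq_of_degN_eq {n : ℕ} {a : Fin n → ℕ} {u v w : Fin n →₀ ℕ}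
    (hf : IndispBinomial K (curveIdeal K a) (monomial u (1 : K) - monomial v (1 : K)))
    (hw : degN a w = degN a u) (huv : degN a u = degN a v) : w = u ∨ w = v := by
  classical
  by_contra! hne
  set f := monomial u (1 : K) - monomial v (1 : K) with hf_def
  have hfw : coeff w f = 0 := by simp [hf_def, coeff_monomial, hne.1.symm, hne.2.symm]
  set S : Set (MvPolynomial (Fin n) K) := { g | (∃ p q : Fin n →₀ ℕ, degN a p = degN a q ∧
    g = monomial p (1 : K) - monomial q (1 : K)) ∧ g ≠ f ∧ g ≠ -f } with hS_def
  have mem_S_of_coeff {g : MvPolynomial (Fin n) K} (hg : ∃ p q : Fin n →₀ ℕ,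
      degN a p = degN a q ∧ g = monomial p (1 : K) - monomial q (1 : K))
      (hgw : coeff w g ≠ 0) : g ∈ S := by
    refine ⟨hg, ?_, ?_⟩ <;> rintro rfl
    · exact hgw hfw
    · exact hgw (by rw [coeff_neg, hfw, neg_zero])
  have hfS : f ∈ Ideal.span S := by
    have h_split : f = (monomial u (1 : K) - monomial w 1) + (monomial w 1 - monomial v 1) := by
      rw [hf_def]
      ring
    rw [h_split]
    refine add_mem (Ideal.subset_span (mem_S_of_coeff ⟨u, w, hw.symm, rfl⟩ ?_))
      (Ideal.subset_span (mem_S_of_coeff ⟨w, v, hw.trans huv, rfl⟩ ?_))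
    · simp [coeff_monomial, hne.1.symm]
    · simp [coeff_monomial, hne.2.symm]
  have hgen : IsBinomGenSet K (curveIdeal K a) S := by
    refine ⟨fun g ⟨⟨p, q, _, hg⟩, _⟩ => ⟨p, q, hg⟩, le_antisymm ?_ ?_⟩
    · exact Ideal.span_mono fun g hg => hg.1
    · refine Ideal.span_le.mpr fun g hg => ?_
      by_cases h1 : g = f
      · exact h1 ▸ hfS
      by_cases h2 : g = -f
      · exact h2 ▸ neg_mem hfS
      exact Ideal.subset_span ⟨hg, h1, h2⟩
  rcases hf S hgen with h | h
  · exact h.2.1 rfl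
  · exact h.2.2 rfl

/-- If `I_A` is generated by its indispensable binomials, the fiber of `x_i^{c_i}` contains only
one other monomial. -/
lemma eq_of_degN_eq_single_of_indispBinomial {n : ℕ} {a c : Fin n → ℕ} (ha : ∀ i, 0 < a i)
    (hc : ∀ i, IsCritExp a i (c i))
    (h : curveIdeal K a = Ideal.span { f | IndispBinomial K (curveIdeal K a) f }) {i : Fin n}
    {u v : Fin n →₀ ℕ}
    (hu : u ≠ Finsupp.single i (c i)) (hudeg : degN a u = degN a (Finsupp.single i (c i)))
    (hv : v ≠ Finsupp.single i (c i)) (hvdeg : degN a v = degN a (Finsupp.single i (c i))) :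
    u = v := by
  obtain ⟨-, u₀, hu₀, hdeg⟩ := (hc i).1
  have hmem := mem_curveIdeal_of_degN_eq K ((degN_single a i (c i)).trans hdeg)
  have hcrit : IsCritBinom K a c i _ := ⟨u₀, hu₀, rfl, hmem⟩
  obtain ⟨w, -, hw, hwS⟩ := exists_binomial_of_isCritBinom K ha hc hcrit
    (S := { f | IndispBinomial K (curveIdeal K a) f })
    (fun s hs => let ⟨p, q, _, hpq⟩ := IndispBinomial.exists_degN_eq K hs; ⟨p, q, hpq⟩)
    (fun s hs => by rw [h]; exact Ideal.subset_span hs)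
    (h ▸ hmem)
  have fiber (z : Fin n →₀ ℕ) (hz : z ≠ Finsupp.single i (c i))
      (hzdeg : degN a z = degN a (Finsupp.single i (c i))) : z = w := by
    rcases hwS with hwS | hwS
    · exact (IndispBinomial.eq_or_eq_of_degN_eq K hwS hzdeg hw.symm).resolve_left hz
    · exact (IndispBinomial.eq_or_eq_of_degN_eq K hwS (hzdeg.trans hw.symm) hw).resolve_right hz
  rw [fiber u hu hudeg, fiber v hv hvdeg]

/-- If the defining ideal `I_A` of the monomial curve is generated by its
indispensable binomials, then so is the critical ideal `C_A`. -/
theorem statement10 {n : ℕ} (a c : Fin n → ℕ) (ha : ∀ i, 0 < a i)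
    (hgcd : Finset.univ.gcd a = 1) (hc : ∀ i, IsCritExp a i (c i))
    (h : curveIdeal K a = Ideal.span { f | IndispBinomial K (curveIdeal K a) f }) :
    criticalIdeal K a c = Ideal.span { f | IndispBinomial K (criticalIdeal K a c) f } := by
  refine le_antisymm (Ideal.span_le.mpr ?_) (Ideal.span_le.mpr ?_)
  · rintro f ⟨i, hcrit⟩
    refine Ideal.subset_span fun S hS => ?_
    have hSJ : S ⊆ criticalIdeal K a c := fun s hs => hS.2 ▸ Ideal.subset_span hs
    have hfJ : f ∈ criticalIdeal K a c := Ideal.subset_span ⟨i, hcrit⟩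
    obtain ⟨w, hw, hwdeg, hwS⟩ := exists_binomial_of_isCritBinom K ha hc hcrit hS.1
      (fun s hs => criticalIdeal_le_curveIdeal K a c (hSJ hs)) (hS.2.symm ▸ hfJ)
    obtain ⟨u, hu, rfl, hmem⟩ := hcrit
    have hne : u ≠ Finsupp.single i (c i) := by
      rintro rfl
      exact (hc i).1.1.ne' (by simpa using hu)
    obtain rfl := eq_of_degN_eq_single_of_indispBinomial K ha hc h hne
      (degN_eq_of_mem_curveIdeal K hmem).symm hw hwdeg
    rwa [neg_sub]
  · intro f hf
    have hgen : IsBinomGenSet K (criticalIdeal K a c) { f | ∃ i, IsCritBinom K a c i f } :=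
      ⟨fun _ ⟨i, u, _, hfu, _⟩ => ⟨_, u, hfu⟩, rfl⟩
    rcases hf _ hgen with hmem | hmem
    · exact Ideal.subset_span hmem
    · exact neg_mem_iff.mp (Ideal.subset_span hmem)
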